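/- Suppose c_p = 1 for all p ∈ {0, …, n}, so that N_p = N for all p. Then for any bounded measurable function φ on X: N V_n^N(1) = N^{−1} Σ_{i ∈ [N]} (#_n^i − 1)² − n + R_N, and N V_n^N(φ − η_n^N(φ)) = N^{−1} Σ_{i ∈ [N]} (#_n^i Δ_n^i)² + R'_N, where the remainder sequences satisfy that N R_N and N R'_N are bounded in probability as N → ∞ (i.e., R_N and R'_N are O_p(1/N)). -/

import Mathlib

open MeasureTheory ProbabilityTheory Filter
open scoped ENNReal NNReal Classical

noncomputable section

namespace PFVar

variable {X : Type*} [MeasurableSpace X]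

/-- The unnormalized Feynman–Kac measures `γ_p`. -/
def gammaFK (M0 : Measure X) (M : ℕ → Kernel X X) (G : ℕ → X → ℝ) : ℕ → Measure X
  | 0 => M0
  | p + 1 =>
      ((gammaFK M0 M G p).withDensity fun x => ENNReal.ofReal (G p x)).bind
        (fun x => M (p + 1) x)

/-- `γ_n(φ)`. -/
def gInt (M0 : Measure X) (M : ℕ → Kernel X X) (G : ℕ → X → ℝ) (n : ℕ) (φ : X → ℝ) : ℝ :=
  ∫ x, φ x ∂(gammaFK M0 M G n)

/-- `η_n(φ) = γ_n(φ)/γ_n(1)`. -/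
def eInt (M0 : Measure X) (M : ℕ → Kernel X X) (G : ℕ → X → ℝ) (n : ℕ) (φ : X → ℝ) : ℝ :=
  gInt M0 M G n φ / gInt M0 M G n 1

/-- Law of the path `(X_0,…,X_k)` of an inhomogeneous Markov chain with initial law `μ0` and
transitions `κ`, recorded as an element of `ℕ → Y` (coordinates beyond `k` are junk). -/
def markovPath {Y : Type*} [MeasurableSpace Y] (μ0 : Measure Y) (κ : ℕ → Y → Measure Y) :
    ℕ → Measure (ℕ → Y)
  | 0 => μ0.map fun y _ => y
  | k + 1 =>
      (markovPath μ0 κ k).bind fun ω =>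
        (κ (k + 1) (ω k)).map fun y => Function.update ω (k + 1) y

/-- Categorical distribution on `{0,…,m−1} ⊆ ℕ` with weights `w`. -/
def cat (m : ℕ) (w : ℕ → ℝ) : Measure ℕ :=
  (∑ j ∈ Finset.range m, ENNReal.ofReal (w j))⁻¹ •
    ∑ j ∈ Finset.range m, ENNReal.ofReal (w j) • Measure.dirac j

/-- Uniform distribution on `{0,…,m−1}`. -/
def unif (m : ℕ) : Measure ℕ := cat m fun _ => 1

/-- Extend a finite tuple to `ℕ` with junk values. -/
def padF {Y : Type*} [Nonempty Y] {m : ℕ} (f : Fin m → Y) : ℕ → Y := fun i =>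
  if h : i < m then f ⟨i, h⟩ else Classical.arbitrary Y

/-- One resampling/mutation step of the particle filter: given the time-`p` configuration `z`,
the joint law of the ancestor indices `A_p` and the time-`p+1` particle configuration;
each of the `Np (p+1)` new particles independently draws an ancestor from the categorical
distribution with weights `G p (z j)`, `j < Np p`, and then moves according to `M (p+1)`. -/
def pfStep [Nonempty X] (M : ℕ → Kernel X X) (G : ℕ → X → ℝ) (Np : ℕ → ℕ) (p : ℕ)
    (z : ℕ → X) : Measure ((ℕ → ℕ) × (ℕ → X)) :=
  (Measure.pi fun _ : Fin (Np (p + 1)) =>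
      (cat (Np p) fun j => G p (z j)).bind fun a =>
        (M (p + 1) (z a)).map fun x => (a, x)).map fun f =>
    (padF fun i => (f i).1, padF fun i => (f i).2)

/-- The law of the particle system `(ζ, A)` run up to time `k`: the first component is
`ζ : time → particle index → X`, the second is `A : time → particle index → ℕ`, where
`A p i` is the ancestor index of particle `i` of generation `p+1`. -/
def pfLaw [Nonempty X] (M0 : Measure X) (M : ℕ → Kernel X X) (G : ℕ → X → ℝ)
    (Np : ℕ → ℕ) : ℕ → Measure ((ℕ → ℕ → X) × (ℕ → ℕ → ℕ))
  | 0 =>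
      (Measure.pi fun _ : Fin (Np 0) => M0).map fun f =>
        (fun p => if p = 0 then padF f else fun _ => Classical.arbitrary X, fun _ _ => 0)
  | k + 1 =>
      (pfLaw M0 M G Np k).bind fun ω =>
        (pfStep M G Np k (ω.1 k)).map fun az =>
          (Function.update ω.1 (k + 1) az.2, Function.update ω.2 k az.1)

/-- Eve indices: `eve A 0 i = i` and `eve A (p+1) i = eve A p (A p i)`. -/
def eve (A : ℕ → ℕ → ℕ) : ℕ → ℕ → ℕ
  | 0 => fun i => i
  | p + 1 => fun i => eve A p (A p i)

/-- `η_n^N(φ)`. -/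
def etaN (Np : ℕ → ℕ) (n : ℕ) (φ : X → ℝ) (ω : (ℕ → ℕ → X) × (ℕ → ℕ → ℕ)) : ℝ :=
  (Np n : ℝ)⁻¹ * ∑ i ∈ Finset.range (Np n), φ (ω.1 n i)

/-- `γ_n^N(φ)`. -/
def gammaN (G : ℕ → X → ℝ) (Np : ℕ → ℕ) (n : ℕ) (φ : X → ℝ)
    (ω : (ℕ → ℕ → X) × (ℕ → ℕ → ℕ)) : ℝ :=
  (∏ p ∈ Finset.range n, etaN Np p (G p) ω) * etaN Np n φ ω

/-- The variance estimator `V_n^N(φ)`. -/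
def Vest (Np : ℕ → ℕ) (n : ℕ) (φ : X → ℝ) (ω : (ℕ → ℕ → X) × (ℕ → ℕ → ℕ)) : ℝ :=
  etaN Np n φ ω ^ 2 -
    (∏ p ∈ Finset.range n, (Np p : ℝ) / ((Np p : ℝ) - 1)) *
      ((Np n : ℝ) * ((Np n : ℝ) - 1))⁻¹ *
      ∑ i ∈ Finset.range (Np n), ∑ j ∈ Finset.range (Np n),
        if eve ω.2 n i ≠ eve ω.2 n j then φ (ω.1 n i) * φ (ω.1 n j) else 0

/-- Initial law of the doubled chain used to define `μ_b`. -/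
def pairInit (M0 : Measure X) (b : ℕ → Bool) : Measure (X × X) :=
  if b 0 then M0.map fun x => (x, x) else M0.prod M0

/-- Transitions of the doubled chain used to define `μ_b`. -/
def pairKer (M : ℕ → Kernel X X) (b : ℕ → Bool) (p : ℕ) (q : X × X) : Measure (X × X) :=
  if b p then (M p q.1).map fun y => (y, y) else (M p q.1).prod (M p q.2)

/-- `μ_b(φ) = E_b[φ(X_n, X_n') ∏_{p<n} G_p(X_p) G_p(X_p')]`. -/
def muB (M0 : Measure X) (M : ℕ → Kernel X X) (G : ℕ → X → ℝ) (n : ℕ) (b : ℕ → Bool)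
    (φ : X × X → ℝ) : ℝ :=
  ∫ ω, φ (ω n) * ∏ p ∈ Finset.range n, G p (ω p).1 * G p (ω p).2
    ∂(markovPath (pairInit M0 b) (pairKer M b) n)

/-- `φ ⊗ φ`. -/
def tens (φ : X → ℝ) : X × X → ℝ := fun q => φ q.1 * φ q.2

/-- The binary string `e_p`. -/
def eVec (p : ℕ) : ℕ → Bool := fun q => q == p

/-- The zero binary string `0_n`. -/
def zeroVec : ℕ → Bool := fun _ => false

/-- Extension of a finite binary string to `ℕ → Bool`. -/
def extB (n : ℕ) (b : Fin (n + 1) → Bool) : ℕ → Bool := fun p =>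
  if h : p < n + 1 then b ⟨p, h⟩ else false

/-- `v_{p,n}(φ) = (μ_{e_p}(φ⊗φ) − μ_{0_n}(φ⊗φ)) / γ_n(1)²`. -/
def vpn (M0 : Measure X) (M : ℕ → Kernel X X) (G : ℕ → X → ℝ) (n p : ℕ) (φ : X → ℝ) : ℝ :=
  (muB M0 M G n (eVec p) (tens φ) - muB M0 M G n zeroVec (tens φ)) / gInt M0 M G n 1 ^ 2

/-- `σ_n²(φ) = Σ_{p=0}^n c_p⁻¹ v_{p,n}(φ)`. -/
def sigma2 (M0 : Measure X) (M : ℕ → Kernel X X) (G : ℕ → X → ℝ) (c : ℕ → ℝ) (n : ℕ)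
    (φ : X → ℝ) : ℝ :=
  ∑ p ∈ Finset.range (n + 1), (c p)⁻¹ * vpn M0 M G n p φ

/-- Particle numbers `N_p = ⌈c_p N⌉`. -/
def npart (c : ℕ → ℝ) (N : ℕ) (p : ℕ) : ℕ := ⌈c p * (N : ℝ)⌉₊

/-- Backward tracing: `traceAux A n kn j = K_{n-j}` where `K_n = kn`, `K_p = A p (K_{p+1})`. -/
def traceAux (A : ℕ → ℕ → ℕ) (n kn : ℕ) : ℕ → ℕ
  | 0 => kn
  | j + 1 => A (n - (j + 1)) (traceAux A n kn j)

/-- The deterministic ancestral trace `K¹`: `trace A n kn p = K_p¹` given `K_n¹ = kn`. -/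
def trace (A : ℕ → ℕ → ℕ) (n kn : ℕ) : ℕ → ℕ := fun p => traceAux A n kn (n - p)

/-- Conditional law of the broken-lineage trace `(K_0²,…,K_p²)` given `K_p² = v`
(entries above `p` are junk, to be overwritten). -/
def k2Law (G : ℕ → X → ℝ) (Np : ℕ → ℕ) (ω : (ℕ → ℕ → X) × (ℕ → ℕ → ℕ)) (K1 : ℕ → ℕ) :
    ℕ → ℕ → Measure (ℕ → ℕ)
  | 0 => fun v => Measure.dirac fun q => if q = 0 then v else 0
  | p + 1 => fun v =>
      ((if v = K1 (p + 1) then cat (Np p) fun j => G p (ω.1 p j)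
          else Measure.dirac (ω.2 p v)).bind fun w =>
        (k2Law G Np ω K1 p w).map fun f => Function.update f (p + 1) v)

/-- Conditional law of `(K¹, K²)` given the particle system `ω = (ζ, A)`. -/
def kLaw (G : ℕ → X → ℝ) (Np : ℕ → ℕ) (n : ℕ) (ω : (ℕ → ℕ → X) × (ℕ → ℕ → ℕ)) :
    Measure ((ℕ → ℕ) × (ℕ → ℕ)) :=
  (unif (Np n)).bind fun k1n =>
    (unif (Np n)).bind fun k2n =>
      (k2Law G Np ω (trace ω.2 n k1n) n k2n).map fun k2 => (trace ω.2 n k1n, k2)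

/-- Joint law of the particle system together with the tracing variables `(K¹, K²)`. -/
def pfkLaw [Nonempty X] (M0 : Measure X) (M : ℕ → Kernel X X) (G : ℕ → X → ℝ)
    (Np : ℕ → ℕ) (n : ℕ) :
    Measure (((ℕ → ℕ → X) × (ℕ → ℕ → ℕ)) × ((ℕ → ℕ) × (ℕ → ℕ))) :=
  (pfLaw M0 M G Np n).bind fun ω => (kLaw G Np n ω).map fun k => (ω, k)

/-- `(k¹, k²) ∈ I(b)`. -/
def inI (Np : ℕ → ℕ) (n : ℕ) (b : ℕ → Bool) (k : (ℕ → ℕ) × (ℕ → ℕ)) : Prop :=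
  ∀ p ≤ n, k.1 p < Np p ∧ k.2 p < Np p ∧ (k.1 p = k.2 p ↔ b p = true)

/-- The particle approximation `μ_b^N(φ)` (a function of the realization `ω = (ζ, A)`);
the conditional expectation given `(A, ζ)` is the integral with respect to `kLaw`. -/
def muBN (G : ℕ → X → ℝ) (Np : ℕ → ℕ) (n : ℕ) (b : ℕ → Bool) (φ : X × X → ℝ)
    (ω : (ℕ → ℕ → X) × (ℕ → ℕ → ℕ)) : ℝ :=
  (∏ p ∈ Finset.range (n + 1),
      if b p then (Np p : ℝ) else (Np p : ℝ) / ((Np p : ℝ) - 1)) *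
    gammaN G Np n 1 ω ^ 2 *
    ∫ k, (if inI Np n b k then (1 : ℝ) else 0) * φ (ω.1 n (k.1 n), ω.1 n (k.2 n))
      ∂(kLaw G Np n ω)

/-- `v_{p,n}^N(φ)`. -/
def vpnN (G : ℕ → X → ℝ) (Np : ℕ → ℕ) (n p : ℕ) (φ : X → ℝ)
    (ω : (ℕ → ℕ → X) × (ℕ → ℕ → ℕ)) : ℝ :=
  (muBN G Np n (eVec p) (tens φ) ω - muBN G Np n zeroVec (tens φ) ω) / gammaN G Np n 1 ω ^ 2

/-- `v_n^N(φ) = Σ_{p=0}^n c_p⁻¹ v_{p,n}^N(φ)`. -/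
def vnN (G : ℕ → X → ℝ) (Np : ℕ → ℕ) (c : ℕ → ℝ) (n : ℕ) (φ : X → ℝ)
    (ω : (ℕ → ℕ → X) × (ℕ → ℕ → ℕ)) : ℝ :=
  ∑ p ∈ Finset.range (n + 1), (c p)⁻¹ * vpnN G Np n p φ ω

/-- `QAux M G n φ j = Q_{n-j,n}(φ)`. -/
def QAux (M : ℕ → Kernel X X) (G : ℕ → X → ℝ) (n : ℕ) (φ : X → ℝ) : ℕ → X → ℝ
  | 0 => φ
  | j + 1 => fun x => G (n - (j + 1)) x * ∫ y, QAux M G n φ j y ∂(M (n - j) x)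

/-- `Q_{p,n}(φ)` where `Q_p(x, dx') = G_{p-1}(x) M_p(x, dx')`, `Q_{n,n} = Id`,
`Q_{p,n} = Q_{p+1} ⋯ Q_n`. -/
def Qpn (M : ℕ → Kernel X X) (G : ℕ → X → ℝ) (n p : ℕ) (φ : X → ℝ) : X → ℝ :=
  QAux M G n φ (n - p)

/-- `φ̂ = G_n · φ`. -/
def hatf (G : ℕ → X → ℝ) (n : ℕ) (φ : X → ℝ) : X → ℝ := fun x => G n x * φ x

/-- `γ̂_n(φ) = γ_n(G_n φ)`. -/
def gHatInt (M0 : Measure X) (M : ℕ → Kernel X X) (G : ℕ → X → ℝ) (n : ℕ) (φ : X → ℝ) : ℝ :=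
  gInt M0 M G n (hatf G n φ)

/-- `η̂_n(φ) = γ̂_n(φ)/γ̂_n(1)`. -/
def eHatInt (M0 : Measure X) (M : ℕ → Kernel X X) (G : ℕ → X → ℝ) (n : ℕ) (φ : X → ℝ) : ℝ :=
  gHatInt M0 M G n φ / gHatInt M0 M G n 1

/-- `γ̂_n^N(φ) = γ_n^N(G_n φ)`. -/
def gammaHatN (G : ℕ → X → ℝ) (Np : ℕ → ℕ) (n : ℕ) (φ : X → ℝ)
    (ω : (ℕ → ℕ → X) × (ℕ → ℕ → ℕ)) : ℝ :=
  gammaN G Np n (hatf G n φ) ω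

/-- `η̂_n^N(φ) = γ̂_n^N(φ)/γ̂_n^N(1)`. -/
def etaHatN (G : ℕ → X → ℝ) (Np : ℕ → ℕ) (n : ℕ) (φ : X → ℝ)
    (ω : (ℕ → ℕ → X) × (ℕ → ℕ → ℕ)) : ℝ :=
  gammaHatN G Np n φ ω / gammaHatN G Np n 1 ω

/-- `v̂_{p,n}(φ) = v_{p,n}(φ̂)/η_n(G_n)²`. -/
def vpnHat (M0 : Measure X) (M : ℕ → Kernel X X) (G : ℕ → X → ℝ) (n p : ℕ) (φ : X → ℝ) : ℝ :=
  vpn M0 M G n p (hatf G n φ) / eInt M0 M G n (G n) ^ 2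

/-- `σ̂_n²(φ) = Σ_{p=0}^n c_p⁻¹ v̂_{p,n}(φ)`. -/
def sigma2Hat (M0 : Measure X) (M : ℕ → Kernel X X) (G : ℕ → X → ℝ) (c : ℕ → ℝ) (n : ℕ)
    (φ : X → ℝ) : ℝ :=
  ∑ p ∈ Finset.range (n + 1), (c p)⁻¹ * vpnHat M0 M G n p φ

/-- `V̂_n^N(φ) = V_n^N(φ̂)/η_n^N(G_n)²`. -/
def VestHat (G : ℕ → X → ℝ) (Np : ℕ → ℕ) (n : ℕ) (φ : X → ℝ)
    (ω : (ℕ → ℕ → X) × (ℕ → ℕ → ℕ)) : ℝ :=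
  Vest Np n (hatf G n φ) ω / etaN Np n (G n) ω ^ 2

/-- `v̂_{p,n}^N(φ) = v_{p,n}^N(φ̂)/η_n^N(G_n)²`. -/
def vpnHatN (G : ℕ → X → ℝ) (Np : ℕ → ℕ) (n p : ℕ) (φ : X → ℝ)
    (ω : (ℕ → ℕ → X) × (ℕ → ℕ → ℕ)) : ℝ :=
  vpnN G Np n p (hatf G n φ) ω / etaN Np n (G n) ω ^ 2

/-- `v̂_n^N(φ) = Σ_{p=0}^n c_p⁻¹ v̂_{p,n}^N(φ)`. -/
def vnHatN (G : ℕ → X → ℝ) (Np : ℕ → ℕ) (c : ℕ → ℝ) (n : ℕ) (φ : X → ℝ)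
    (ω : (ℕ → ℕ → X) × (ℕ → ℕ → ℕ)) : ℝ :=
  ∑ p ∈ Finset.range (n + 1), (c p)⁻¹ * vpnHatN G Np n p φ ω


open PFVar MeasureTheory ProbabilityTheory Filter

lemma bind_apply_le {α β : Type*} [MeasurableSpace α] [MeasurableSpace β] (m : Measure α)
    (f : α → Measure β) {s : Set β} (hs : MeasurableSet s) :
    m.bind f s ≤ ∫⁻ a, f a s ∂m := by
  by_cases hf : AEMeasurable f m
  · exact (Measure.bind_apply hs hf).le
  · simp [Measure.bind, Measure.map_of_not_aemeasurable hf]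

lemma map_apply_le {α β : Type*} [MeasurableSpace α] [MeasurableSpace β] (m : Measure α)
    (f : α → β) {s : Set β} (hs : MeasurableSet s) :
    m.map f s ≤ m (f ⁻¹' s) := by
  by_cases hf : AEMeasurable f m
  · exact (Measure.map_apply_of_aemeasurable hf hs).le
  · simp [Measure.map_of_not_aemeasurable hf]

lemma lintegral_cat (m : ℕ) (w : ℕ → ℝ) (h : ℕ → ℝ≥0∞) :
    ∫⁻ a, h a ∂(cat m w) = (∑ j ∈ Finset.range m, ENNReal.ofReal (w j))⁻¹ *
      ∑ j ∈ Finset.range m, ENNReal.ofReal (w j) * h j := by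
  simp [cat, lintegral_finsetSum_measure]

/-- The joint law of the ancestor index and the position of one new particle. -/
def childLaw (M : ℕ → Kernel X X) (G : ℕ → X → ℝ) (N p : ℕ) (z : ℕ → X) : Measure (ℕ × X) :=
  (cat N fun j => G p (z j)).bind fun a => (M (p + 1) (z a)).map fun x => (a, x)

lemma lintegral_childLaw (M : ℕ → Kernel X X) (G : ℕ → X → ℝ) (N p : ℕ) (z : ℕ → X)
    {h : ℕ × X → ℝ≥0∞} (hh : Measurable h) :
    ∫⁻ y, h y ∂(childLaw M G N p z) =
      (∑ j ∈ Finset.range N, ENNReal.ofReal (G p (z j)))⁻¹ *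
        ∑ j ∈ Finset.range N, ENNReal.ofReal (G p (z j)) *
          ∫⁻ x, h (j, x) ∂(M (p + 1) (z j)) := by
  rw [childLaw, Measure.lintegral_bind (measurable_from_nat).aemeasurable hh.aemeasurable,
    lintegral_cat]
  congr 1
  refine Finset.sum_congr rfl fun j _ => ?_
  rw [lintegral_map hh measurable_prodMk_left]

lemma childLaw_isProbabilityMeasure (M : ℕ → Kernel X X) [∀ p, IsMarkovKernel (M p)]
    (G : ℕ → X → ℝ) {N p : ℕ} (hN : 0 < N) (hG : ∀ x, 0 < G p x) (z : ℕ → X) :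
    IsProbabilityMeasure (childLaw M G N p z) := by
  constructor
  have h := lintegral_childLaw M G N p z (h := fun _ => 1) measurable_const
  simp only [lintegral_const, one_mul, measure_univ, mul_one] at h
  rw [h]
  apply ENNReal.inv_mul_cancel
  · rw [← ENNReal.ofReal_sum_of_nonneg fun j _ => (hG _).le]
    have : 0 < ∑ j ∈ Finset.range N, G p (z j) :=
      Finset.sum_pos (fun j _ => hG _) ⟨0, by simpa using hN⟩
    simpa using this
  · simp

lemma childLaw_apply_fst (M : ℕ → Kernel X X) [∀ p, IsMarkovKernel (M p)]
    (G : ℕ → X → ℝ) (N p : ℕ) (z : ℕ → X) (l : ℕ) :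
    childLaw M G N p z {y | y.1 = l} =
      (∑ j ∈ Finset.range N, ENNReal.ofReal (G p (z j)))⁻¹ *
        if l < N then ENNReal.ofReal (G p (z l)) else 0 := by
  have hm : MeasurableSet {y : ℕ × X | y.1 = l} := measurable_fst (measurableSet_singleton l)
  rw [← lintegral_indicator_one hm, lintegral_childLaw M G N p z (measurable_one.indicator hm)]
  congr 1
  simp only [Set.indicator, Set.mem_ofPred_eq, Pi.one_apply]
  rw [← Finset.sum_filter_add_sum_filter_not _ (fun j => j = l)]
  rw [Finset.sum_eq_zero (s := Finset.filter (fun j => ¬ j = l) _)]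
  · rw [Finset.filter_eq']
    simp only [Finset.mem_range]
    split_ifs <;> simp
  · intro j hj
    simp [(Finset.mem_filter.mp hj).2]

lemma childLaw_fst_ge (M : ℕ → Kernel X X) (G : ℕ → X → ℝ) (N p : ℕ) (z : ℕ → X) :
    childLaw M G N p z {y | N ≤ y.1} = 0 := by
  have hm : MeasurableSet {y : ℕ × X | N ≤ y.1} := measurable_fst (measurableSet_Ici (a := N))
  rw [← lintegral_indicator_one hm, lintegral_childLaw M G N p z (measurable_one.indicator hm)]
  refine mul_eq_zero_of_right _ (Finset.sum_eq_zero fun j hj => ?_)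
  have : ¬ N ≤ j := by simpa using hj
  simp [Set.indicator, this]

/-- The particle system `ω` extended by generation `k + 1`. -/
def extendStep {Y : Type*} [Nonempty Y] {N : ℕ} (k : ℕ) (ω : (ℕ → ℕ → Y) × (ℕ → ℕ → ℕ))
    (f : Fin N → ℕ × Y) : (ℕ → ℕ → Y) × (ℕ → ℕ → ℕ) :=
  (Function.update ω.1 (k + 1) (padF fun i => (f i).2),
    Function.update ω.2 k (padF fun i => (f i).1))

lemma pfLaw_succ_le [Nonempty X] (M0 : Measure X) (M : ℕ → Kernel X X) (G : ℕ → X → ℝ)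
    (N k : ℕ) {B : Set ((ℕ → ℕ → X) × (ℕ → ℕ → ℕ))} (hB : MeasurableSet B) :
    pfLaw M0 M G (fun _ => N) (k + 1) B ≤
      ∫⁻ ω, (Measure.pi fun _ : Fin N => childLaw M G N k (ω.1 k)) {f | extendStep k ω f ∈ B}
        ∂(pfLaw M0 M G (fun _ => N) k) := by
  rw [pfLaw]
  refine (bind_apply_le _ _ hB).trans (lintegral_mono fun ω => ?_)
  refine (map_apply_le _ _ hB).trans ?_
  rw [pfStep]
  have hu : Measurable fun az : (ℕ → ℕ) × (ℕ → X) =>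
      (Function.update ω.1 (k + 1) az.2, Function.update ω.2 k az.1) :=
    ((measurable_update ω.1).comp measurable_snd).prodMk
      ((measurable_update ω.2).comp measurable_fst)
  exact map_apply_le _ _ (hu hB)

lemma pfLaw_univ_le [Nonempty X] (M0 : Measure X) [IsProbabilityMeasure M0]
    (M : ℕ → Kernel X X) [∀ p, IsMarkovKernel (M p)] (G : ℕ → X → ℝ) {N k : ℕ} (hN : 0 < N)
    (hG : ∀ p < k, ∀ x, 0 < G p x) :
    pfLaw M0 M G (fun _ => N) k Set.univ ≤ 1 := by
  induction k with
  | zero =>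
    rw [pfLaw]
    exact (map_apply_le _ _ MeasurableSet.univ).trans (by simp)
  | succ k ih =>
    refine (pfLaw_succ_le M0 M G N k MeasurableSet.univ).trans ?_
    have := fun z => childLaw_isProbabilityMeasure M G hN (hG k k.lt_succ_self) z
    refine (lintegral_mono (g := fun _ => 1) fun ω => ?_).trans ?_
    · exact prob_le_one
    · simpa using ih fun p hp => hG p (hp.trans k.lt_succ_self)

lemma pfLaw_succ_le_add [Nonempty X] (M0 : Measure X) [IsProbabilityMeasure M0]
    (M : ℕ → Kernel X X) [∀ p, IsMarkovKernel (M p)] (G : ℕ → X → ℝ) {N k : ℕ} (hN : 0 < N)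
    (hG : ∀ p ≤ k, ∀ x, 0 < G p x) {B bad : Set ((ℕ → ℕ → X) × (ℕ → ℕ → ℕ))}
    (hB : MeasurableSet B) {ε : ℝ≥0∞}
    (h : ∀ ω ∉ bad,
      (Measure.pi fun _ : Fin N => childLaw M G N k (ω.1 k)) {f | extendStep k ω f ∈ B} ≤ ε) :
    pfLaw M0 M G (fun _ => N) (k + 1) B ≤ pfLaw M0 M G (fun _ => N) k bad + ε := by
  have hp := fun z => childLaw_isProbabilityMeasure M G hN (hG k le_rfl) z
  refine (pfLaw_succ_le M0 M G N k hB).trans ?_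
  refine (lintegral_mono (g := fun ω => bad.indicator (fun _ => 1) ω + ε) fun ω => ?_).trans ?_
  · by_cases hω : ω ∈ bad
    · simp only [hω, Set.indicator_of_mem]
      exact prob_le_one.trans le_self_add
    · simpa [hω] using h ω hω
  · rw [lintegral_add_right _ measurable_const, lintegral_const]
    refine add_le_add ((lintegral_indicator_const_le _ _).trans (by simp)) ?_
    exact mul_le_of_le_one_right' (pfLaw_univ_le M0 M G hN fun p hp => hG p hp.le)

lemma measurable_eve (p i : ℕ) :
    Measurable fun ω : (ℕ → ℕ → X) × (ℕ → ℕ → ℕ) => eve ω.2 p i := by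
  induction p generalizing i with
  | zero => exact measurable_const
  | succ p ih =>
    have h1 : Measurable fun q : ℕ × ((ℕ → ℕ → X) × (ℕ → ℕ → ℕ)) => eve q.2.2 p q.1 :=
      measurable_from_prod_countable_right fun j => ih j
    have h2 : Measurable fun ω : (ℕ → ℕ → X) × (ℕ → ℕ → ℕ) => ω.2 p i := by fun_prop
    exact h1.comp (h2.prodMk measurable_id)

lemma eve_congr {A B : ℕ → ℕ → ℕ} {k : ℕ} (h : ∀ p < k, A p = B p) : eve A k = eve B k := by
  induction k with
  | zero => rfl
  | succ k ih =>
    funext i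
    simp only [eve, h k k.lt_succ_self, ih fun p hp => h p (hp.trans k.lt_succ_self)]

lemma eve_extendStep {Y : Type*} [Nonempty Y] {N : ℕ} (k : ℕ) (ω : (ℕ → ℕ → Y) × (ℕ → ℕ → ℕ))
    (f : Fin N → ℕ × Y) (i : Fin N) :
    eve (extendStep k ω f).2 (k + 1) i = eve ω.2 k (f i).1 := by
  have h : eve (Function.update ω.2 k (padF fun i => (f i).1)) k = eve ω.2 k :=
    eve_congr fun p hp => Function.update_of_ne hp.ne _ _
  simp [extendStep, eve, h, padF]

lemma fst_extendStep {Y : Type*} [Nonempty Y] {N : ℕ} (k : ℕ) (ω : (ℕ → ℕ → Y) × (ℕ → ℕ → ℕ))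
    (f : Fin N → ℕ × Y) (i : Fin N) :
    (extendStep k ω f).1 (k + 1) i = (f i).2 := by
  simp [extendStep, padF]

lemma exp_neg_le_one_sub_half {t : ℝ} (h0 : 0 ≤ t) (h1 : t ≤ 1) : Real.exp (-t) ≤ 1 - t / 2 := by
  rw [Real.exp_neg, inv_le_comm₀ (Real.exp_pos t) (by linarith)]
  refine le_trans ?_ (Real.add_one_le_exp t)
  rw [inv_le_iff_one_le_mul₀ (by linarith)]
  nlinarith

/-- A Chernoff lower-tail bound for sums of i.i.d. `[0, 1]`-valued variables. -/
lemma pi_sum_le_exp {Y : Type*} [MeasurableSpace Y] (ν : Measure Y) [IsProbabilityMeasure ν]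
    (N : ℕ) {f : Y → ℝ} (hf : Measurable f) (h0 : ∀ y, 0 ≤ f y) (h1 : ∀ y, f y ≤ 1)
    {m δ : ℝ} (hm : m ≤ ∫ y, f y ∂ν) :
    (Measure.pi fun _ : Fin N => ν) {x | ∑ i, f (x i) ≤ δ * N} ≤
      ENNReal.ofReal (Real.exp (-((m / 2 - δ) * N))) := by
  have hfi : Integrable f ν := Integrable.of_bound hf.aestronglyMeasurable 1
    (Eventually.of_forall fun y => by simpa [abs_of_nonneg (h0 y)] using h1 y)
  have hei : Integrable (fun y => Real.exp (-f y)) ν :=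
    Integrable.of_bound (by fun_prop) 1
      (Eventually.of_forall fun y => by simpa using h0 y)
  have hE : ∫ y, Real.exp (-f y) ∂ν ≤ Real.exp (-(m / 2)) := by
    calc ∫ y, Real.exp (-f y) ∂ν ≤ ∫ y, (1 - f y / 2) ∂ν :=
          integral_mono hei ((integrable_const 1).sub (hfi.div_const 2))
            fun y => exp_neg_le_one_sub_half (h0 y) (h1 y)
      _ = 1 - (∫ y, f y ∂ν) / 2 := by
          rw [integral_sub (integrable_const 1) (hfi.div_const 2), integral_div]
          simp
      _ ≤ 1 - m / 2 := by linarith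
      _ ≤ Real.exp (-(m / 2)) := Real.one_sub_le_exp_neg _
  have hprod : ∫ x, ∏ i, Real.exp (-f (x i)) ∂(Measure.pi fun _ : Fin N => ν) ≤
      Real.exp (-(m / 2)) ^ N := by
    rw [integral_fintype_prod_eq_prod (fun _ y => Real.exp (-f y)), Finset.prod_const]
    simpa using pow_le_pow_left₀ (integral_nonneg fun y => (Real.exp_pos _).le) hE N
  have hmk := mul_meas_ge_le_integral_of_nonneg (μ := Measure.pi fun _ : Fin N => ν)
    (Eventually.of_forall fun x => Finset.prod_nonneg fun i _ => (Real.exp_pos (-f (x i))).le)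
    (Integrable.fintype_prod (f := fun _ y => Real.exp (-f y)) fun _ => hei)
    (Real.exp (-(δ * N)))
  have hset : {x : Fin N → Y | ∑ i, f (x i) ≤ δ * N} =
      {x | Real.exp (-(δ * N)) ≤ ∏ i, Real.exp (-f (x i))} := by
    ext x
    simp [← Real.exp_sum]
  rw [hset, ← ofReal_measureReal]
  apply ENNReal.ofReal_le_ofReal
  have h2 := hmk.trans hprod
  rw [mul_comm, ← le_div_iff₀ (Real.exp_pos _), ← Real.exp_nat_mul, ← Real.exp_sub] at h2
  refine h2.trans (le_of_eq ?_)
  congr 1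
  ring

lemma pi_eval_mem {Y : Type*} [MeasurableSpace Y] (ν : Measure Y) [IsProbabilityMeasure ν]
    {N : ℕ} (i : Fin N) {s : Set Y} (hs : MeasurableSet s) :
    (Measure.pi fun _ : Fin N => ν) {f | f i ∈ s} = ν s :=
  (measurePreserving_eval (fun _ : Fin N => ν) i).measure_preimage hs.nullMeasurableSet

lemma pi_eval_mem_and {Y : Type*} [MeasurableSpace Y] (ν : Measure Y) [IsProbabilityMeasure ν]
    {N : ℕ} {i j : Fin N} (hij : i ≠ j) (s t : Set Y) :
    (Measure.pi fun _ : Fin N => ν) {f | f i ∈ s ∧ f j ∈ t} = ν s * ν t := by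
  have h : {f : Fin N → Y | f i ∈ s ∧ f j ∈ t} =
      Set.univ.pi fun m => if m = i then s else if m = j then t else Set.univ := by
    ext f
    simp only [Set.mem_ofPred_eq, Set.mem_pi, Set.mem_univ, true_imp_iff]
    constructor
    · rintro ⟨h1, h2⟩ m
      split_ifs with hi hj
      · exact hi ▸ h1
      · exact hj ▸ h2
      · trivial
    · intro h
      exact ⟨by simpa using h i, by simpa [hij.symm] using h j⟩
  rw [h, Measure.pi_pi, ← Finset.mul_prod_erase _ _ (Finset.mem_univ i),
    ← Finset.mul_prod_erase _ _ (Finset.mem_erase.mpr ⟨hij.symm, Finset.mem_univ j⟩),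
    Finset.prod_eq_one]
  · simp [hij.symm]
  · intro m hm
    simp only [Finset.mem_erase] at hm
    simp [hm.1, hm.2.1]

/-- The number of pairs in `{0, …, N - 1}²` on which `e` takes equal values. -/
def coincidences (N : ℕ) (e : ℕ → ℕ) : ℕ :=
  ∑ i ∈ Finset.range N, ∑ j ∈ Finset.range N, if e i = e j then 1 else 0

lemma pi_eq_le {ν : Measure (ℕ × X)} [IsProbabilityMeasure ν] {N : ℕ} {c : ℝ≥0∞}
    (hc : ∀ l, ν {y | y.1 = l} ≤ c) (hN : ν {y | N ≤ y.1} = 0) (e : ℕ → ℕ)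
    {i j : Fin N} (hij : i ≠ j) :
    (Measure.pi fun _ : Fin N => ν) {f | e (f i).1 = e (f j).1} ≤ c ^ 2 * coincidences N e := by
  set P := Measure.pi fun _ : Fin N => ν
  have hm : MeasurableSet {y : ℕ × X | N ≤ y.1} := measurable_fst (measurableSet_Ici (a := N))
  have hsub : {f : Fin N → ℕ × X | e (f i).1 = e (f j).1} ⊆
      ({f | f i ∈ {y : ℕ × X | N ≤ y.1}} ∪ {f | f j ∈ {y : ℕ × X | N ≤ y.1}}) ∪
      ⋃ l ∈ Finset.range N, ⋃ l' ∈ Finset.range N,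
        {f | e l = e l' ∧ (f i ∈ {y : ℕ × X | y.1 = l} ∧ f j ∈ {y : ℕ × X | y.1 = l'})} := by
    intro f hf
    by_cases h1 : N ≤ (f i).1
    · exact Or.inl (Or.inl h1)
    by_cases h2 : N ≤ (f j).1
    · exact Or.inl (Or.inr h2)
    refine Or.inr ?_
    simp only [Set.mem_iUnion, Finset.mem_range]
    exact ⟨(f i).1, not_le.mp h1, (f j).1, not_le.mp h2, hf, rfl, rfl⟩
  refine (measure_mono hsub).trans ((measure_union_le _ _).trans ?_)
  have h0 : P ({f | f i ∈ {y : ℕ × X | N ≤ y.1}} ∪ {f | f j ∈ {y : ℕ × X | N ≤ y.1}}) = 0 := by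
    refine measure_union_null ?_ ?_
    · exact (pi_eval_mem ν i hm).trans hN
    · exact (pi_eval_mem ν j hm).trans hN
  rw [h0, zero_add, coincidences]
  push_cast
  rw [Finset.mul_sum]
  refine (measure_biUnion_finset_le _ _).trans (Finset.sum_le_sum fun l _ => ?_)
  rw [Finset.mul_sum]
  refine (measure_biUnion_finset_le _ _).trans (Finset.sum_le_sum fun l' _ => ?_)
  by_cases hl : e l = e l'
  · simp only [hl, true_and, if_true, mul_one]
    rw [pi_eval_mem_and ν hij, sq]
    exact mul_le_mul' (hc l) (hc l')
  · simp [hl]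

lemma lintegral_coincidences_le {ν : Measure (ℕ × X)} [IsProbabilityMeasure ν] {N : ℕ} {c : ℝ≥0∞}
    (hc : ∀ l, ν {y | y.1 = l} ≤ c) (hN : ν {y | N ≤ y.1} = 0) (e : ℕ → ℕ) :
    ∫⁻ f, ∑ i : Fin N, ∑ j : Fin N, (if e (f i).1 = e (f j).1 then 1 else 0 : ℝ≥0∞)
        ∂(Measure.pi fun _ : Fin N => ν) ≤
      N + N ^ 2 * (c ^ 2 * coincidences N e) := by
  have hme : ∀ i j : Fin N, MeasurableSet {f : Fin N → ℕ × X | e (f i).1 = e (f j).1} := by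
    intro i j
    refine measurableSet_eq_fun ?_ ?_ <;>
      exact (measurable_from_nat (f := e)).comp (measurable_fst.comp (measurable_pi_apply _))
  have hmi : ∀ i j : Fin N, Measurable fun f : Fin N → ℕ × X =>
      (if e (f i).1 = e (f j).1 then 1 else 0 : ℝ≥0∞) := fun i j =>
    Measurable.ite (hme i j) measurable_const measurable_const
  rw [lintegral_finsetSum _ fun i _ => Finset.measurable_sum _ fun j _ => hmi i j]
  have hterm : ∀ i j : Fin N, ∫⁻ f, (if e (f i).1 = e (f j).1 then 1 else 0 : ℝ≥0∞)
        ∂(Measure.pi fun _ : Fin N => ν) ≤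
      (if j = i then 1 else 0) + c ^ 2 * coincidences N e := by
    intro i j
    have : (fun f : Fin N → ℕ × X => (if e (f i).1 = e (f j).1 then 1 else 0 : ℝ≥0∞)) =
        {f : Fin N → ℕ × X | e (f i).1 = e (f j).1}.indicator 1 := by
      ext f
      simp [Set.indicator]
    rw [this, lintegral_indicator_one (hme i j)]
    by_cases hij : j = i
    · rw [if_pos hij]
      exact prob_le_one.trans le_self_add
    · exact (pi_eq_le hc hN e (Ne.symm hij)).trans le_add_self
  calc _ ≤ ∑ i : Fin N, ∑ j : Fin N, ((if j = i then 1 else 0) + c ^ 2 * coincidences N e) := by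
        refine Finset.sum_le_sum fun i _ => ?_
        rw [lintegral_finsetSum _ fun j _ => hmi i j]
        exact Finset.sum_le_sum fun j _ => hterm i j
    _ = _ := by
        simp [Finset.sum_add_distrib]
        ring

lemma pfLaw_le_eve_eq_zero [Nonempty X] (M0 : Measure X) [IsProbabilityMeasure M0]
    (M : ℕ → Kernel X X) [∀ p, IsMarkovKernel (M p)] (G : ℕ → X → ℝ) {N k : ℕ} (hN : 0 < N)
    (hG : ∀ p < k, ∀ x, 0 < G p x) :
    pfLaw M0 M G (fun _ => N) k {ω | ∃ i < N, N ≤ eve ω.2 k i} = 0 := by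
  have hmeas : ∀ k, MeasurableSet
      {ω : (ℕ → ℕ → X) × (ℕ → ℕ → ℕ) | ∃ i < N, N ≤ eve ω.2 k i} := by
    intro k
    have : {ω : (ℕ → ℕ → X) × (ℕ → ℕ → ℕ) | ∃ i < N, N ≤ eve ω.2 k i} =
        ⋃ i ∈ Finset.range N, {ω | N ≤ eve ω.2 k i} := by
      ext ω
      simp
    rw [this]
    exact Finset.measurableSet_biUnion _ fun i _ => measurable_eve k i (measurableSet_Ici (a := N))
  induction k with
  | zero =>
    have : {ω : (ℕ → ℕ → X) × (ℕ → ℕ → ℕ) | ∃ i < N, N ≤ eve ω.2 0 i} = ∅ := by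
      ext ω
      simp [eve]
    rw [this, measure_empty]
  | succ k ih =>
    have hp := fun z => childLaw_isProbabilityMeasure M G hN (hG k k.lt_succ_self) z
    have h := pfLaw_succ_le_add M0 M G hN (fun p hp => hG p (Nat.lt_succ_of_le hp))
      (hmeas (k + 1)) (bad := {ω | ∃ i < N, N ≤ eve ω.2 k i}) (ε := 0) ?_
    · rw [ih fun p hp => hG p (hp.trans k.lt_succ_self), add_zero] at h
      exact le_antisymm h zero_le
    intro ω hω
    refine le_of_eq (measure_mono_null (t := ⋃ i, {f | f i ∈ {y : ℕ × X | N ≤ y.1}}) ?_ ?_)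
    · rintro f ⟨i, hi, hle⟩
      rw [Set.mem_iUnion]
      refine ⟨⟨i, hi⟩, ?_⟩
      by_contra hlt
      have h1 := eve_extendStep k ω f ⟨i, hi⟩
      exact hω ⟨(f ⟨i, hi⟩).1, not_le.mp hlt, h1 ▸ hle⟩
    · refine measure_iUnion_null fun i => ?_
      exact (pi_eval_mem _ i (measurable_fst (measurableSet_Ici (a := N)))).trans
        (childLaw_fst_ge M G N k _)

lemma eventually_exp_neg_mul_le {δ ε : ℝ} (hδ : 0 < δ) (hε : 0 < ε) :
    ∀ᶠ N : ℕ in atTop, Real.exp (-(δ * N)) ≤ ε := by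
  have h : Tendsto (fun N : ℕ => Real.exp (-(δ * N))) atTop (nhds 0) :=
    Real.tendsto_exp_neg_atTop_nhds_zero.comp
      (tendsto_natCast_atTop_atTop.const_mul_atTop hδ)
  exact h.eventually_le_const hε

/-- Averages of a positive function over the particles are bounded away from `0` in
probability. -/
lemma pfLaw_sum_le_tight [Nonempty X] (M0 : Measure X) [IsProbabilityMeasure M0]
    (M : ℕ → Kernel X X) [∀ p, IsMarkovKernel (M p)] (G : ℕ → X → ℝ) {k : ℕ}
    (hGm : ∀ p < k, Measurable (G p)) (hGpos : ∀ p < k, ∀ x, 0 < G p x)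
    (hGbd : ∀ p < k, ∃ C, ∀ x, G p x ≤ C)
    {f : X → ℝ} (hf : Measurable f) (h0 : ∀ x, 0 < f x) (h1 : ∀ x, f x ≤ 1)
    {ε : ℝ} (hε : 0 < ε) :
    ∃ δ : ℝ, 0 < δ ∧ ∀ᶠ N : ℕ in atTop,
      pfLaw M0 M G (fun _ => N) k {ω | ∑ i ∈ Finset.range N, f (ω.1 k i) ≤ δ * N} ≤
        ENNReal.ofReal ε := by
  have hmeas : ∀ (f : X → ℝ), Measurable f → ∀ (k N : ℕ) (δ : ℝ), MeasurableSet
      {ω : (ℕ → ℕ → X) × (ℕ → ℕ → ℕ) | ∑ i ∈ Finset.range N, f (ω.1 k i) ≤ δ * N} := by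
    intro f hf k N δ
    exact measurableSet_le (by fun_prop) measurable_const
  have hpos : ∀ {μ : Measure X} [IsProbabilityMeasure μ] {f : X → ℝ}, Measurable f →
      (∀ x, 0 < f x) → (∀ x, f x ≤ 1) → Integrable f μ ∧ 0 < ∫ x, f x ∂μ ∧ ∫ x, f x ∂μ ≤ 1 := by
    intro μ _ f hf h0 h1
    have hi : Integrable f μ := Integrable.of_bound hf.aestronglyMeasurable 1
      (Eventually.of_forall fun y => by simpa [abs_of_nonneg (h0 y).le] using h1 y)
    refine ⟨hi, ?_, ?_⟩
    · rw [integral_pos_iff_support_of_nonneg (fun x => (h0 x).le) hi]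
      have : Function.support f = Set.univ := Set.eq_univ_of_forall fun x => (h0 x).ne'
      simp [this]
    · simpa using integral_mono hi (integrable_const 1) h1
  induction k generalizing f ε with
  | zero =>
    obtain ⟨hi, hmpos, -⟩ := hpos (μ := M0) hf h0 h1
    refine ⟨(∫ x, f x ∂M0) / 4, by linarith, ?_⟩
    filter_upwards [eventually_exp_neg_mul_le (δ := (∫ x, f x ∂M0) / 4) (by linarith) hε]
      with N hN
    rw [pfLaw]
    refine (map_apply_le _ _ (hmeas f hf 0 N _)).trans ?_
    have h := pi_sum_le_exp M0 N hf (fun x => (h0 x).le) h1 (δ := (∫ x, f x ∂M0) / 4) le_rfl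
    refine le_trans (measure_mono fun x hx => ?_) (h.trans (ENNReal.ofReal_le_ofReal ?_))
    · simpa [Finset.sum_range, padF] using hx
    · convert hN using 3
      ring
  | succ k ih =>
    obtain ⟨C', hC'⟩ := hGbd k k.lt_succ_self
    have hGk := hGpos k k.lt_succ_self
    have hC : ∀ x, G k x ≤ C' := hC'
    have hCpos : 0 < C' := (hGk (Classical.arbitrary X)).trans_le (hC _)
    set g : X → ℝ := fun x => G k x / C' * ∫ y, f y ∂(M (k + 1) x) with hg
    have hgm : Measurable g := ((hGm k k.lt_succ_self).div_const C').mul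
      (hf.stronglyMeasurable.integral_kernel (κ := M (k + 1))).measurable
    have hg0 : ∀ x, 0 < g x := fun x =>
      mul_pos (div_pos (hGk x) hCpos) (hpos hf h0 h1).2.1
    have hg1 : ∀ x, g x ≤ 1 := fun x =>
      mul_le_one₀ ((div_le_one hCpos).mpr (hC x)) (hpos hf h0 h1).2.1.le (hpos hf h0 h1).2.2
    obtain ⟨δ, hδ, hev⟩ := ih (fun p hp => hGm p (hp.trans k.lt_succ_self))
      (fun p hp => hGpos p (hp.trans k.lt_succ_self))
      (fun p hp => hGbd p (hp.trans k.lt_succ_self)) hgm hg0 hg1 (half_pos hε)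
    refine ⟨δ / 4, by linarith, ?_⟩
    filter_upwards [hev, eventually_exp_neg_mul_le (δ := δ / 4) (by linarith) (half_pos hε),
      eventually_gt_atTop 0] with N hN hexp hN0
    have hp := fun z => childLaw_isProbabilityMeasure M G hN0 hGk z
    have hstep := pfLaw_succ_le_add M0 M G hN0 (fun p hp => hGpos p (Nat.lt_succ_of_le hp))
      (hmeas f hf (k + 1) N (δ / 4))
      (bad := {ω | ∑ i ∈ Finset.range N, g (ω.1 k i) ≤ δ * N}) (ε := ENNReal.ofReal (ε / 2)) ?_
    · refine hstep.trans ((add_le_add_left hN _).trans ?_)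
      rw [← ENNReal.ofReal_add (by linarith) (by linarith)]
      simp
    intro ω hω
    have hω' : δ * N < ∑ i ∈ Finset.range N, g (ω.1 k i) := not_le.mp hω
    set z := ω.1 k with hz
    have hNr : (0 : ℝ) < N := by exact_mod_cast hN0
    have hW0 : 0 < ∑ j ∈ Finset.range N, G k (z j) :=
      Finset.sum_pos (fun j _ => hGk _) ⟨0, by simpa using hN0⟩
    have hWle : ∑ j ∈ Finset.range N, G k (z j) ≤ N * C' := by
      simpa using Finset.sum_le_card_nsmul (Finset.range N) (fun j => G k (z j)) C' fun j _ => hC _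
    have hmean : δ ≤ ∫ y, f y.2 ∂(childLaw M G N k z) := by
      have hfi : Integrable (fun y : ℕ × X => f y.2) (childLaw M G N k z) :=
        Integrable.of_bound (hf.comp measurable_snd).aestronglyMeasurable 1
          (Eventually.of_forall fun y => by simpa [abs_of_nonneg (h0 _).le] using h1 y.2)
      rw [← ENNReal.ofReal_le_ofReal_iff (integral_nonneg fun y => (h0 _).le),
        ofReal_integral_eq_lintegral_ofReal hfi (Eventually.of_forall fun y => (h0 _).le),
        lintegral_childLaw M G N k z (h := fun y => ENNReal.ofReal (f y.2)) (by fun_prop),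
        ← ENNReal.ofReal_sum_of_nonneg fun j _ => (hGk _).le]
      have hterm : ∀ j, ENNReal.ofReal (G k (z j)) *
          ∫⁻ x, ENNReal.ofReal (f x) ∂(M (k + 1) (z j)) = ENNReal.ofReal (C' * g (z j)) := by
        intro j
        rw [← ofReal_integral_eq_lintegral_ofReal (hpos hf h0 h1).1
          (Eventually.of_forall fun y => (h0 _).le), ← ENNReal.ofReal_mul (hGk _).le, hg]
        congr 1
        field_simp
      simp only [hterm]
      rw [← ENNReal.ofReal_sum_of_nonneg fun j _ => (mul_pos hCpos (hg0 _)).le,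
        ← ENNReal.ofReal_inv_of_pos hW0, ← ENNReal.ofReal_mul (inv_nonneg.mpr hW0.le),
        ← Finset.mul_sum]
      apply ENNReal.ofReal_le_ofReal
      rw [inv_mul_eq_div, le_div_iff₀ hW0]
      calc δ * ∑ j ∈ Finset.range N, G k (z j) ≤ δ * (N * C') := by gcongr
        _ = C' * (δ * N) := by ring
        _ ≤ _ := by gcongr
    have h := pi_sum_le_exp (childLaw M G N k z) N (hf.comp measurable_snd)
      (fun y => (h0 _).le) (fun y => h1 _) (δ := δ / 4) hmean
    refine le_trans (measure_mono fun x hx => ?_) (h.trans (ENNReal.ofReal_le_ofReal ?_))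
    · simpa [Finset.sum_range, fst_extendStep] using hx
    · convert hexp using 3
      ring

/-- The normalized number of pairs of particles sharing an Eve index is bounded in
probability. -/
lemma pfLaw_coincidences_tight [Nonempty X] (M0 : Measure X) [IsProbabilityMeasure M0]
    (M : ℕ → Kernel X X) [∀ p, IsMarkovKernel (M p)] (G : ℕ → X → ℝ) {k : ℕ}
    (hGm : ∀ p < k, Measurable (G p)) (hGpos : ∀ p < k, ∀ x, 0 < G p x)
    (hGbd : ∀ p < k, ∃ C, ∀ x, G p x ≤ C) {ε : ℝ} (hε : 0 < ε) :
    ∃ K : ℝ, 0 < K ∧ ∀ᶠ N : ℕ in atTop,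
      pfLaw M0 M G (fun _ => N) k {ω | K * N ≤ (coincidences N (eve ω.2 k) : ℝ)} ≤
        ENNReal.ofReal ε := by
  have hcm : ∀ k N : ℕ, Measurable fun ω : (ℕ → ℕ → X) × (ℕ → ℕ → ℕ) =>
      coincidences N (eve ω.2 k) := by
    intro k N
    refine Finset.measurable_sum _ fun i _ => Finset.measurable_sum _ fun j _ => ?_
    exact Measurable.ite (measurableSet_eq_fun (measurable_eve k i) (measurable_eve k j))
      measurable_const measurable_const
  induction k generalizing ε with
  | zero =>
    refine ⟨2, by norm_num, ?_⟩
    filter_upwards [eventually_gt_atTop 0] with N hN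
    have : {ω : (ℕ → ℕ → X) × (ℕ → ℕ → ℕ) |
        (2 : ℝ) * N ≤ (coincidences N (eve ω.2 0) : ℝ)} = ∅ := by
      ext ω
      have hid : coincidences N (fun i => i) = N := by
        calc coincidences N (fun i => i) = ∑ i ∈ Finset.range N, 1 :=
              Finset.sum_congr rfl fun i hi => by rw [Finset.sum_ite_eq, if_pos hi]
          _ = N := by simp
      have hc : coincidences N (eve ω.2 0) = N := hid
      have : (0 : ℝ) < N := by exact_mod_cast hN
      simp only [hc, Set.mem_ofPred_eq, Set.mem_empty_iff_false, iff_false, not_le]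
      linarith
    rw [this, measure_empty]
    exact zero_le
  | succ k ih =>
    obtain ⟨C, hC⟩ := hGbd k k.lt_succ_self
    have hGk := hGpos k k.lt_succ_self
    have hCpos : 0 < C := (hGk (Classical.arbitrary X)).trans_le (hC _)
    have hε4 : 0 < ε / 4 := by linarith
    obtain ⟨δ, hδ, hev⟩ := pfLaw_sum_le_tight M0 M G (k := k)
      (fun p hp => hGm p (hp.trans k.lt_succ_self))
      (fun p hp => hGpos p (hp.trans k.lt_succ_self))
      (fun p hp => hGbd p (hp.trans k.lt_succ_self))
      (f := fun x => G k x / C) ((hGm k k.lt_succ_self).div_const C)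
      (fun x => div_pos (hGk x) hCpos) (fun x => (div_le_one hCpos).mpr (hC x)) hε4
    obtain ⟨K, hK, hevK⟩ := ih (fun p hp => hGm p (hp.trans k.lt_succ_self))
      (fun p hp => hGpos p (hp.trans k.lt_succ_self))
      (fun p hp => hGbd p (hp.trans k.lt_succ_self)) hε4
    refine ⟨(1 + K / δ ^ 2) / (ε / 2), by positivity, ?_⟩
    filter_upwards [hev, hevK, eventually_gt_atTop 0] with N hN hNK hN0
    have hp := fun z => childLaw_isProbabilityMeasure M G hN0 hGk z
    have hstep := pfLaw_succ_le_add M0 M G hN0 (fun p hp => hGpos p (Nat.lt_succ_of_le hp))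
      (measurableSet_le (measurable_const (a := (1 + K / δ ^ 2) / (ε / 2) * (N : ℝ)))
        ((measurable_from_nat (f := Nat.cast)).comp (hcm (k + 1) N)))
      (bad := {ω | ∑ i ∈ Finset.range N, G k (ω.1 k i) / C ≤ δ * N} ∪
        {ω | K * N ≤ (coincidences N (eve ω.2 k) : ℝ)}) (ε := ENNReal.ofReal (ε / 2)) ?_
    · refine hstep.trans ((add_le_add_left ((measure_union_le _ _).trans
        (add_le_add hN hNK)) _).trans ?_)
      rw [← ENNReal.ofReal_add (by linarith) (by linarith),
        ← ENNReal.ofReal_add (by linarith) (by linarith)]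
      exact ENNReal.ofReal_le_ofReal (by linarith)
    intro ω hω
    simp only [Set.mem_union, Set.mem_ofPred_eq, not_or, not_le] at hω
    obtain ⟨hω1, hω2⟩ := hω
    set z := ω.1 k with hz
    have hNr : (0 : ℝ) < N := by exact_mod_cast hN0
    have hW : C * (δ * N) ≤ ∑ j ∈ Finset.range N, G k (z j) := by
      rw [← Finset.sum_div, lt_div_iff₀ hCpos] at hω1
      linarith
    have hc : ∀ l, childLaw M G N k z {y | y.1 = l} ≤ ENNReal.ofReal (1 / (δ * N)) := by
      intro l
      rw [childLaw_apply_fst, ← ENNReal.ofReal_sum_of_nonneg fun j _ => (hGk _).le]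
      have hW0 : 0 < ∑ j ∈ Finset.range N, G k (z j) := lt_of_lt_of_le (by positivity) hW
      split_ifs
      · rw [← ENNReal.ofReal_inv_of_pos hW0, ← ENNReal.ofReal_mul (inv_nonneg.mpr hW0.le)]
        apply ENNReal.ofReal_le_ofReal
        rw [inv_mul_eq_div, div_le_div_iff₀ hW0 (by positivity)]
        calc G k (z l) * (δ * N) ≤ C * (δ * N) := by
              gcongr
              exact hC _
          _ ≤ _ := by linarith
      · simp
    have hint := lintegral_coincidences_le hc (childLaw_fst_ge M G N k z) (eve ω.2 k)
    have hcoin : ∀ f : Fin N → ℕ × X,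
        (coincidences N (eve (extendStep k ω f).2 (k + 1)) : ℝ≥0∞) =
          ∑ i : Fin N, ∑ j : Fin N,
            (if eve ω.2 k (f i).1 = eve ω.2 k (f j).1 then 1 else 0 : ℝ≥0∞) := by
      intro f
      simp only [coincidences, Finset.sum_range, eve_extendStep]
      push_cast
      rfl
    have hle : (N : ℝ≥0∞) + N ^ 2 * (ENNReal.ofReal (1 / (δ * N)) ^ 2 *
        coincidences N (eve ω.2 k)) ≤ ENNReal.ofReal ((1 + K / δ ^ 2) * N) := by
      rw [← ENNReal.ofReal_natCast N, ← ENNReal.ofReal_natCast (coincidences N (eve ω.2 k)),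
        ← ENNReal.ofReal_pow (by positivity), ← ENNReal.ofReal_pow (by positivity),
        ← ENNReal.ofReal_mul (by positivity), ← ENNReal.ofReal_mul (by positivity),
        ← ENNReal.ofReal_add (by positivity) (by positivity)]
      apply ENNReal.ofReal_le_ofReal
      have : (N : ℝ) ^ 2 * ((1 / (δ * N)) ^ 2 * coincidences N (eve ω.2 k)) =
          coincidences N (eve ω.2 k) / δ ^ 2 := by
        field_simp
      rw [this, add_mul, one_mul, div_mul_eq_mul_div]
      gcongr
    have hb0 : (0 : ℝ) < (1 + K / δ ^ 2) / (ε / 2) * N := by positivity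
    have hae : Measurable fun f : Fin N → ℕ × X => ∑ i : Fin N, ∑ j : Fin N,
        (if eve ω.2 k (f i).1 = eve ω.2 k (f j).1 then 1 else 0 : ℝ≥0∞) := by
      refine Finset.measurable_sum _ fun i _ => Finset.measurable_sum _ fun j _ => ?_
      refine Measurable.ite (measurableSet_eq_fun ?_ ?_) measurable_const measurable_const <;>
        exact (measurable_from_nat (f := eve ω.2 k)).comp
          (measurable_fst.comp (measurable_pi_apply _))
    have hmk := meas_ge_le_lintegral_div (μ := Measure.pi fun _ : Fin N => childLaw M G N k z)
      hae.aemeasurable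
      (ε := ENNReal.ofReal ((1 + K / δ ^ 2) / (ε / 2) * N)) (by simpa using hb0)
      ENNReal.ofReal_ne_top
    refine le_trans (measure_mono fun f hf => ?_) (hmk.trans ?_)
    · rw [Set.mem_ofPred_eq, ← hcoin, ← ENNReal.ofReal_natCast (coincidences N _)]
      exact ENNReal.ofReal_le_ofReal hf
    · refine (ENNReal.div_le_div_right (hint.trans hle) _).trans ?_
      rw [← ENNReal.ofReal_div_of_pos hb0]
      apply ENNReal.ofReal_le_ofReal (le_of_eq _)
      have : 1 + K / δ ^ 2 ≠ 0 := by positivity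
      field_simp

lemma sum_sq_fiber_sum {N : ℕ} {e : ℕ → ℕ} (he : ∀ i < N, e i < N) (ψ : ℕ → ℝ) :
    ∑ k ∈ Finset.range N, (∑ j ∈ (Finset.range N).filter fun j => e j = k, ψ j) ^ 2 =
      ∑ i ∈ Finset.range N, ∑ j ∈ Finset.range N, if e i = e j then ψ i * ψ j else 0 := by
  have h : ∀ k, (∑ j ∈ (Finset.range N).filter fun j => e j = k, ψ j) ^ 2 =
      ∑ i ∈ Finset.range N, ∑ j ∈ Finset.range N,
        if e i = k then (if e j = k then ψ i * ψ j else 0) else 0 := by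
    intro k
    rw [sq, Finset.sum_filter, Finset.sum_mul_sum]
    refine Finset.sum_congr rfl fun i _ => Finset.sum_congr rfl fun j _ => ?_
    split_ifs <;> simp
  simp only [h]
  rw [Finset.sum_comm]
  refine Finset.sum_congr rfl fun i hi => ?_
  rw [Finset.sum_comm]
  refine Finset.sum_congr rfl fun j _ => ?_
  rw [Finset.sum_ite_eq, if_pos (Finset.mem_range.mpr (he i (Finset.mem_range.mp hi)))]
  simp only [eq_comm]

lemma sum_ne_fiber {N : ℕ} {e : ℕ → ℕ} (he : ∀ i < N, e i < N) (ψ : ℕ → ℝ) :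
    ∑ i ∈ Finset.range N, ∑ j ∈ Finset.range N, (if e i ≠ e j then ψ i * ψ j else 0) =
      (∑ i ∈ Finset.range N, ψ i) ^ 2 -
        ∑ k ∈ Finset.range N, (∑ j ∈ (Finset.range N).filter fun j => e j = k, ψ j) ^ 2 := by
  rw [sum_sq_fiber_sum he, sq, Finset.sum_mul_sum, ← Finset.sum_sub_distrib]
  refine Finset.sum_congr rfl fun i _ => ?_
  rw [← Finset.sum_sub_distrib]
  refine Finset.sum_congr rfl fun j _ => ?_
  by_cases h : e i = e j <;> simp [h]

lemma sum_sq_card_fiber {N : ℕ} {e : ℕ → ℕ} (he : ∀ i < N, e i < N) :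
    ∑ k ∈ Finset.range N, (((Finset.range N).filter fun j => e j = k).card : ℝ) ^ 2 =
      coincidences N e := by
  have h := sum_sq_fiber_sum he fun _ => 1
  simp only [Finset.sum_const, nsmul_eq_mul, mul_one] at h
  rw [h, coincidences]
  push_cast
  rfl

lemma sum_card_fiber {N : ℕ} {e : ℕ → ℕ} (he : ∀ i < N, e i < N) :
    ∑ k ∈ Finset.range N, (((Finset.range N).filter fun j => e j = k).card : ℝ) = N := by
  have h := Finset.card_eq_sum_card_fiberwise (s := Finset.range N) (t := Finset.range N) (f := e)
    fun i hi => by simpa using he i (by simpa using hi)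
  rw [Finset.card_range] at h
  exact_mod_cast h.symm

lemma Vest_eq {Y : Type*} {N n : ℕ} {ω : (ℕ → ℕ → Y) × (ℕ → ℕ → ℕ)}
    (he : ∀ i < N, eve ω.2 n i < N) (φ : Y → ℝ) :
    Vest (fun _ => N) n φ ω = ((N : ℝ)⁻¹ * ∑ i ∈ Finset.range N, φ (ω.1 n i)) ^ 2 -
      ((N : ℝ) / ((N : ℝ) - 1)) ^ n * ((N : ℝ) * ((N : ℝ) - 1))⁻¹ *
        ((∑ i ∈ Finset.range N, φ (ω.1 n i)) ^ 2 -
          ∑ k ∈ Finset.range N,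
            (∑ j ∈ (Finset.range N).filter fun j => eve ω.2 n j = k, φ (ω.1 n j)) ^ 2) := by
  rw [← sum_ne_fiber he fun i => φ (ω.1 n i)]
  simp only [Vest, etaN, Finset.prod_const, Finset.card_range]

lemma one_add_pow_sub_bounds {x : ℝ} (h0 : 0 ≤ x) (h1 : x ≤ 1) (m : ℕ) :
    0 ≤ (1 + x) ^ m - 1 - m * x ∧ (1 + x) ^ m - 1 - m * x ≤ 4 ^ m * x ^ 2 := by
  induction m with
  | zero => simpa using sq_nonneg x
  | succ m ih =>
    have hm : (m : ℝ) ≤ 2 * 4 ^ m := by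
      have : m < 4 ^ m := Nat.lt_pow_self (by norm_num)
      have : (m : ℝ) < 4 ^ m := by exact_mod_cast this
      linarith [this, Nat.cast_nonneg (α := ℝ) m]
    have hrec : (1 + x) ^ (m + 1) - 1 - ((m + 1 : ℕ) : ℝ) * x =
        (1 + x) * ((1 + x) ^ m - 1 - m * x) + m * x ^ 2 := by
      push_cast
      ring
    rw [hrec]
    refine ⟨add_nonneg (mul_nonneg (by linarith) ih.1) (by positivity), ?_⟩
    calc (1 + x) * ((1 + x) ^ m - 1 - m * x) + m * x ^ 2 ≤
          2 * (4 ^ m * x ^ 2) + 2 * 4 ^ m * x ^ 2 := by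
          gcongr
          · exact ih.1
          · linarith
          · exact ih.2
      _ = 4 ^ (m + 1) * x ^ 2 := by ring

lemma correction_factor_eq {N : ℝ} (hN : 2 ≤ N) (n : ℕ) :
    (N / (N - 1)) ^ n * (N * (N - 1))⁻¹ = (1 + 1 / (N - 1)) ^ (n + 1) / N ^ 2 := by
  have h1 : N - 1 ≠ 0 := by linarith
  have h2 : N ≠ 0 := by linarith
  have : 1 + 1 / (N - 1) = N / (N - 1) := by
    field_simp
    ring
  rw [this, pow_succ]
  field_simp

lemma correction_factor_sub_one_mul_le {N : ℝ} (hN : 2 ≤ N) (m : ℕ) {S K : ℝ} (hK : 0 ≤ K)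
    (h0 : 0 ≤ S) (hS : S ≤ K * N) :
    0 ≤ ((1 + 1 / (N - 1)) ^ m - 1) * S ∧
      ((1 + 1 / (N - 1)) ^ m - 1) * S ≤ 2 * (m + 4 ^ m) * K := by
  set x := 1 / (N - 1) with hx
  have hx0 : 0 ≤ x := by
    rw [hx]
    exact div_nonneg zero_le_one (by linarith)
  have hx1 : x ≤ 1 := by
    rw [hx, div_le_one (by linarith)]
    linarith
  have hNx : N * x = 1 + x := by
    have : N - 1 ≠ 0 := by linarith
    rw [hx]
    field_simp
    ring
  obtain ⟨hr0, hr⟩ := one_add_pow_sub_bounds hx0 hx1 m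
  have ha0 : 0 ≤ (1 + x) ^ m - 1 := by
    have : 0 ≤ m * x := by positivity
    linarith
  have ha : (1 + x) ^ m - 1 ≤ (m + 4 ^ m) * x := by
    have : (4 : ℝ) ^ m * x ^ 2 ≤ 4 ^ m * x := by
      gcongr
      nlinarith
    linarith
  refine ⟨mul_nonneg ha0 h0, ?_⟩
  calc ((1 + x) ^ m - 1) * S ≤ ((m + 4 ^ m) * x) * (K * N) := by
        gcongr
    _ = (m + 4 ^ m) * K * (N * x) := by ring
    _ ≤ (m + 4 ^ m) * K * 2 := by
        gcongr
        linarith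
    _ = _ := by ring

lemma abs_unit_remainder_le {N : ℝ} (hN : 2 ≤ N) (n : ℕ) {S K : ℝ} (hK : 0 ≤ K)
    (h0 : 0 ≤ S) (hS : S ≤ K * N) :
    |N * (N * (1 - (N / (N - 1)) ^ n * (N * (N - 1))⁻¹ * (N ^ 2 - S)) -
      (N⁻¹ * (S - N) - n))| ≤
      4 * 4 ^ (n + 1) + 2 * ((n + 1 : ℕ) : ℝ) + 2 * (((n + 1 : ℕ) : ℝ) + 4 ^ (n + 1)) * K := by
  obtain ⟨hA0, hA⟩ := correction_factor_sub_one_mul_le hN (n + 1) hK h0 hS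
  rw [correction_factor_eq hN]
  set x := 1 / (N - 1) with hx
  have hx0 : 0 ≤ x := by
    rw [hx]
    exact div_nonneg zero_le_one (by linarith)
  have hx1 : x ≤ 1 := by
    rw [hx, div_le_one (by linarith)]
    linarith
  have hNx : N * x = 1 + x := by
    have : N - 1 ≠ 0 := by linarith
    rw [hx]
    field_simp
    ring
  obtain ⟨hr0, hr⟩ := one_add_pow_sub_bounds hx0 hx1 (n + 1)
  set a := (1 + x) ^ (n + 1) with ha
  set r := a - 1 - ((n + 1 : ℕ) : ℝ) * x with hrdef
  have hN0 : N ≠ 0 := by linarith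
  have heq : N * (N * (1 - a / N ^ 2 * (N ^ 2 - S)) - (N⁻¹ * (S - N) - n)) =
      -(N ^ 2 * r) - ((n + 1 : ℕ) : ℝ) * (1 + x) + (a - 1) * S := by
    have e1 : N * (N * (1 - a / N ^ 2 * (N ^ 2 - S)) - (N⁻¹ * (S - N) - n)) =
        N ^ 2 * (1 - a) + (n + 1) * N + (a - 1) * S := by
      field_simp
      ring
    have e2 : N * (N * x) = N + (1 + x) := by
      rw [hNx, mul_add, hNx]
      ring
    rw [e1, hrdef]
    push_cast
    linear_combination ((-(n : ℝ)) - 1) * e2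
  have hNr0 : 0 ≤ N ^ 2 * r := by positivity
  have hNr : N ^ 2 * r ≤ 4 * 4 ^ (n + 1) := by
    calc N ^ 2 * r ≤ N ^ 2 * (4 ^ (n + 1) * x ^ 2) := by gcongr
      _ = (N * x) ^ 2 * 4 ^ (n + 1) := by ring
      _ ≤ 4 * 4 ^ (n + 1) := by
          gcongr
          rw [hNx]
          nlinarith
  have hm : ((n + 1 : ℕ) : ℝ) * (1 + x) ≤ 2 * ((n + 1 : ℕ) : ℝ) := by
    rw [mul_comm]
    gcongr
    linarith
  have hm0 : 0 ≤ ((n + 1 : ℕ) : ℝ) * (1 + x) := by positivity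
  have hb : (0 : ℝ) ≤ 4 * 4 ^ (n + 1) + 2 * ((n + 1 : ℕ) : ℝ) := by positivity
  rw [heq, abs_le]
  constructor <;> linarith

lemma abs_Vest_one_remainder_le {Y : Type*} {N n : ℕ} (hN : 2 ≤ N) {ω : (ℕ → ℕ → Y) × (ℕ → ℕ → ℕ)}
    (he : ∀ i < N, eve ω.2 n i < N) {K : ℝ} (hK : 0 ≤ K)
    (hS : (coincidences N (eve ω.2 n) : ℝ) ≤ K * N) :
    |(N : ℝ) * ((N : ℝ) * Vest (fun _ => N) n (1 : Y → ℝ) ω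
      - ((N : ℝ)⁻¹ * (∑ i ∈ Finset.range N,
          ((((Finset.range N).filter fun j => eve ω.2 n j = i).card : ℝ) - 1) ^ 2)
        - n))| ≤
      4 * 4 ^ (n + 1) + 2 * ((n + 1 : ℕ) : ℝ) + 2 * (((n + 1 : ℕ) : ℝ) + 4 ^ (n + 1)) * K := by
  have hsum : ∑ i ∈ Finset.range N,
      ((((Finset.range N).filter fun j => eve ω.2 n j = i).card : ℝ) - 1) ^ 2 =
        (coincidences N (eve ω.2 n) : ℝ) - N := by
    simp only [sub_sq, Finset.sum_add_distrib, Finset.sum_sub_distrib, mul_one,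
      ← Finset.mul_sum, sum_sq_card_fiber he, sum_card_fiber he]
    simp
    ring
  have hN0 : (N : ℝ) ≠ 0 := by positivity
  rw [Vest_eq he, hsum]
  simp only [Pi.one_apply, Finset.sum_const, nsmul_eq_mul, mul_one, sum_sq_card_fiber he,
    Finset.card_range, inv_mul_cancel₀ hN0, one_pow]
  exact abs_unit_remainder_le (by exact_mod_cast hN) n hK (Nat.cast_nonneg _) hS

lemma abs_etaN_le {Y : Type*} {N n : ℕ} {φ : Y → ℝ} {C : ℝ} (hC : ∀ x, |φ x| ≤ C)
    (hN : 0 < N) (ω : (ℕ → ℕ → Y) × (ℕ → ℕ → ℕ)) :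
    |etaN (fun _ => N) n φ ω| ≤ C := by
  have hN0 : (0 : ℝ) < N := by exact_mod_cast hN
  rw [etaN, abs_mul, abs_of_pos (inv_pos.mpr hN0), inv_mul_le_iff₀ hN0]
  refine (Finset.abs_sum_le_sum_abs _ _).trans ?_
  simpa using Finset.sum_le_card_nsmul (Finset.range N) (fun i => |φ (ω.1 n i)|) C fun i _ => hC _

lemma abs_Vest_centered_remainder_le {Y : Type*} {N n : ℕ} (hN : 2 ≤ N) {ω : (ℕ → ℕ → Y) × (ℕ → ℕ → ℕ)}
    (he : ∀ i < N, eve ω.2 n i < N) {K : ℝ} (hK : 0 ≤ K)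
    (hS : (coincidences N (eve ω.2 n) : ℝ) ≤ K * N)
    {φ : Y → ℝ} {C : ℝ} (hC : ∀ x, |φ x| ≤ C) :
    |(N : ℝ) * ((N : ℝ) * Vest (fun _ => N) n
        (fun x => φ x - etaN (fun _ => N) n φ ω) ω
      - (N : ℝ)⁻¹ * ∑ i ∈ Finset.range N,
          (((((Finset.range N).filter fun j => eve ω.2 n j = i).card : ℝ)) *
            (if (((Finset.range N).filter fun j => eve ω.2 n j = i).card) = 0 then 0
              else ((((Finset.range N).filter fun j => eve ω.2 n j = i).card : ℝ))⁻¹ *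
                  (∑ j ∈ (Finset.range N).filter fun j => eve ω.2 n j = i,
                    φ (ω.1 n j))
                - etaN (fun _ => N) n φ ω)) ^ 2)| ≤
      2 * (((n + 1 : ℕ) : ℝ) + 4 ^ (n + 1)) * ((2 * C) ^ 2 * K) := by
  have hN0 : (N : ℝ) ≠ 0 := by positivity
  have hN2 : (2 : ℝ) ≤ N := by exact_mod_cast hN
  have hη := abs_etaN_le (n := n) hC (by lia : 0 < N) ω
  have hmean : ∑ i ∈ Finset.range N, φ (ω.1 n i) = N * etaN (fun _ => N) n φ ω := by
    rw [etaN, mul_inv_cancel_left₀ hN0]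
  set η := etaN (fun _ => N) n φ ω with hηdef
  have hgroup : ∀ i, ((((Finset.range N).filter fun j => eve ω.2 n j = i).card : ℝ)) *
      (if (((Finset.range N).filter fun j => eve ω.2 n j = i).card) = 0 then 0
        else ((((Finset.range N).filter fun j => eve ω.2 n j = i).card : ℝ))⁻¹ *
            (∑ j ∈ (Finset.range N).filter fun j => eve ω.2 n j = i, φ (ω.1 n j)) - η) =
      ∑ j ∈ (Finset.range N).filter fun j => eve ω.2 n j = i, (φ (ω.1 n j) - η) := by
    intro i
    rw [Finset.sum_sub_distrib, Finset.sum_const, nsmul_eq_mul]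
    split_ifs with h
    · rw [Finset.card_eq_zero] at h
      simp [h]
    · have h' : ((((Finset.range N).filter fun j => eve ω.2 n j = i).card : ℝ)) ≠ 0 := by
        exact_mod_cast h
      rw [mul_sub, mul_inv_cancel_left₀ h']
  have hzero : ∑ i ∈ Finset.range N, (φ (ω.1 n i) - η) = 0 := by
    rw [Finset.sum_sub_distrib, hmean]
    simp
  simp only [hgroup]
  rw [Vest_eq he, hzero]
  set Q := ∑ k ∈ Finset.range N,
    (∑ j ∈ (Finset.range N).filter fun j => eve ω.2 n j = k, (φ (ω.1 n j) - η)) ^ 2 with hQ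
  have hQ0 : 0 ≤ Q := Finset.sum_nonneg fun k _ => sq_nonneg _
  have hQle : Q ≤ (2 * C) ^ 2 * K * N := by
    calc Q ≤ ∑ k ∈ Finset.range N,
          (2 * C) ^ 2 * (((Finset.range N).filter fun j => eve ω.2 n j = k).card : ℝ) ^ 2 := by
          refine Finset.sum_le_sum fun k _ => ?_
          rw [← mul_pow, sq_le_sq]
          refine (Finset.abs_sum_le_sum_abs _ _).trans (le_trans ?_ (le_abs_self _))
          refine (Finset.sum_le_card_nsmul _ _ (2 * C) fun j _ => ?_).trans (le_of_eq ?_)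
          · refine (abs_sub _ _).trans ?_
            linarith [hC (ω.1 n j)]
          · rw [nsmul_eq_mul, mul_comm]
      _ = (2 * C) ^ 2 * coincidences N (eve ω.2 n) := by
          rw [← Finset.mul_sum, sum_sq_card_fiber he]
      _ ≤ (2 * C) ^ 2 * (K * N) := by gcongr
      _ = _ := by ring
  obtain ⟨h0, h1⟩ := correction_factor_sub_one_mul_le hN2 (n + 1) (by positivity) hQ0 hQle
  rw [correction_factor_eq hN2]
  have heq : (N : ℝ) * (N * (((N : ℝ)⁻¹ * 0) ^ 2 -
      (1 + 1 / ((N : ℝ) - 1)) ^ (n + 1) / N ^ 2 * (0 ^ 2 - Q)) - (N : ℝ)⁻¹ * Q) =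
      ((1 + 1 / ((N : ℝ) - 1)) ^ (n + 1) - 1) * Q := by
    have : (N : ℝ) - 1 ≠ 0 := by linarith
    generalize (1 + 1 / ((N : ℝ) - 1)) ^ (n + 1) = a
    field_simp
    ring
  rw [heq, abs_of_nonneg h0]
  exact h1

theorem statement4
    {X : Type*} [MeasurableSpace X] [Nonempty X] (hX : ∃ x y : X, x ≠ y) (n : ℕ)
    (M0 : Measure X) [IsProbabilityMeasure M0]
    (M : ℕ → Kernel X X) [∀ p, IsMarkovKernel (M p)]
    (G : ℕ → X → ℝ) (hGm : ∀ p ≤ n, Measurable (G p))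
    (hGpos : ∀ p ≤ n, ∀ x, 0 < G p x) (hGbd : ∀ p ≤ n, ∃ C, ∀ x, G p x ≤ C)
    (φ : X → ℝ) (hφm : Measurable φ) (hφb : ∃ C, ∀ x, |φ x| ≤ C) :
    (∀ ε : ℝ, 0 < ε → ∃ C : ℝ, ∀ᶠ N : ℕ in atTop,
      pfLaw M0 M G (fun _ => N) n
          {ω | C ≤ |(N : ℝ) * ((N : ℝ) * Vest (fun _ => N) n (1 : X → ℝ) ω
              - ((N : ℝ)⁻¹ * (∑ i ∈ Finset.range N,
                  ((((Finset.range N).filter fun j => eve ω.2 n j = i).card : ℝ) - 1) ^ 2)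
                - n))|}
        ≤ ENNReal.ofReal ε) ∧
    (∀ ε : ℝ, 0 < ε → ∃ C : ℝ, ∀ᶠ N : ℕ in atTop,
      pfLaw M0 M G (fun _ => N) n
          {ω | C ≤ |(N : ℝ) * ((N : ℝ) * Vest (fun _ => N) n
                (fun x => φ x - etaN (fun _ => N) n φ ω) ω
              - (N : ℝ)⁻¹ * ∑ i ∈ Finset.range N,
                  (((((Finset.range N).filter fun j => eve ω.2 n j = i).card : ℝ)) *
                    (if (((Finset.range N).filter fun j => eve ω.2 n j = i).card) = 0 then 0
                      else ((((Finset.range N).filter fun j => eve ω.2 n j = i).card : ℝ))⁻¹ *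
                          (∑ j ∈ (Finset.range N).filter fun j => eve ω.2 n j = i,
                            φ (ω.1 n j))
                        - etaN (fun _ => N) n φ ω)) ^ 2)|}
        ≤ ENNReal.ofReal ε) := by
  have key : ∀ ε : ℝ, 0 < ε → ∃ K : ℝ, 0 < K ∧ ∀ᶠ N : ℕ in atTop, 2 ≤ N ∧
      pfLaw M0 M G (fun _ => N) n ({ω | ∃ i < N, N ≤ eve ω.2 n i} ∪
        {ω | K * N ≤ (coincidences N (eve ω.2 n) : ℝ)}) ≤ ENNReal.ofReal ε := by
    intro ε hε
    obtain ⟨K, hK, hev⟩ := pfLaw_coincidences_tight M0 M G (fun p hp => hGm p hp.le)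
      (fun p hp => hGpos p hp.le) (fun p hp => hGbd p hp.le) hε
    refine ⟨K, hK, ?_⟩
    filter_upwards [hev, eventually_ge_atTop 2] with N hN h2
    refine ⟨h2, (measure_union_le _ _).trans ?_⟩
    rwa [pfLaw_le_eve_eq_zero M0 M G (by lia) fun p hp => hGpos p hp.le, zero_add]
  refine ⟨fun ε hε => ?_, fun ε hε => ?_⟩
  · obtain ⟨K, hK, hev⟩ := key ε hε
    refine ⟨4 * 4 ^ (n + 1) + 2 * ((n + 1 : ℕ) : ℝ) +
      2 * (((n + 1 : ℕ) : ℝ) + 4 ^ (n + 1)) * K + 1, ?_⟩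
    filter_upwards [hev] with N hN
    refine (measure_mono fun ω hω => ?_).trans hN.2
    by_contra hbad
    simp only [Set.mem_union, Set.mem_ofPred_eq, not_or, not_exists, not_and, not_le] at hbad
    have h := abs_Vest_one_remainder_le hN.1 hbad.1 hK.le hbad.2.le
    exact (lt_add_one _).not_ge (hω.trans h)
  · obtain ⟨K, hK, hev⟩ := key ε hε
    obtain ⟨C, hC⟩ := hφb
    refine ⟨2 * (((n + 1 : ℕ) : ℝ) + 4 ^ (n + 1)) * ((2 * C) ^ 2 * K) + 1, ?_⟩
    filter_upwards [hev] with N hN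
    refine (measure_mono fun ω hω => ?_).trans hN.2
    by_contra hbad
    simp only [Set.mem_union, Set.mem_ofPred_eq, not_or, not_exists, not_and, not_le] at hbad
    have h := abs_Vest_centered_remainder_le hN.1 hbad.1 hK.le hbad.2.le hC
    exact (lt_add_one _).not_ge (hω.trans h)
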